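/- Let A ∈ ℂ^{n×n} and C_i ∈ ℂ^{1×n} be arbitrary, and set Ã_i := H_i A H_iᴴ and C̃_i := C_i H_iᴴ. Then for every integer k ≥ 0 one has C̃_i Ã_i^k = C_i A^k H_iᴴ; consequently, the n-row stacked matrix whose k-th row is C̃_i Ã_i^{k-1} (k = 1,…,n) equals O_i H_iᴴ. -/

import Mathlib

open Matrix

/-- The observability matrix of the pair `(A, c)` (row `k` is `c · A^k`, `k = 0,…,n-1`). -/
noncomputable def obsMat {n : ℕ} (A : Matrix (Fin n) (Fin n) ℂ) (c : Fin n → ℂ) :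
    Matrix (Fin n) (Fin n) ℂ :=
  Matrix.of fun k j => Matrix.vecMul c (A ^ (k : ℕ)) j

/-- The set of indices of nonzero columns of a matrix. -/
noncomputable def colSupport {r n : ℕ} (M : Matrix (Fin r) (Fin n) ℂ) : Finset (Fin n) :=
  @Finset.filter _ (fun j => ∃ k, M k j ≠ 0) (Classical.decPred _) Finset.univ

/-- The selection matrix of `Q ⊆ {1,…,n}`: its rows are the transposed canonical basis
vectors `e_jᵀ`, `j ∈ Q`, listed in increasing order of `j`. -/
def selMatrix {n d : ℕ} (Q : Finset (Fin n)) (h : Q.card = d) :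
    Matrix (Fin d) (Fin n) ℂ :=
  Matrix.of fun k j => if j = (Q.orderIsoOfFin h k : Fin n) then 1 else 0

/-- A linear functional applied to powers of `A` vanishes identically on a coordinate as soon as it
vanishes there on the first `n` powers. -/
lemma vecMul_pow_apply_eq_zero {n : ℕ} (A : Matrix (Fin n) (Fin n) ℂ) (c : Fin n → ℂ) (j : Fin n)
    (h : ∀ l : Fin n, Matrix.vecMul c (A ^ (l : ℕ)) j = 0) (k : ℕ) :
    Matrix.vecMul c (A ^ k) j = 0 := by
  have hn : 0 < n := j.pos
  have hdeg : A.charpoly.natDegree = n := by simp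
  have hne : A.charpoly ≠ 1 := by
    intro h1
    rw [h1, Polynomial.natDegree_one] at hdeg
    omega
  have hlt := Polynomial.natDegree_modByMonic_lt (Polynomial.X ^ k) A.charpoly_monic hne
  rw [hdeg] at hlt
  rw [Matrix.pow_eq_aeval_mod_charpoly, Polynomial.aeval_eq_sum_range' hlt, Matrix.vecMul_sum,
    Finset.sum_apply]
  refine Finset.sum_eq_zero fun l hl => ?_
  rw [Matrix.vecMul_smul, Pi.smul_apply, h ⟨l, Finset.mem_range.mp hl⟩, smul_zero]

/-- Restricting a vector supported on `Q` to `Q` and extending it by zero gives it back. -/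
lemma vecMul_selMatrix_conjTranspose_vecMul_selMatrix {n d : ℕ} (Q : Finset (Fin n))
    (h : Q.card = d) (v : Fin n → ℂ) (hv : ∀ j ∉ Q, v j = 0) :
    Matrix.vecMul (Matrix.vecMul v (selMatrix Q h)ᴴ) (selMatrix Q h) = v := by
  ext j
  have hrow (k : Fin d) : Matrix.vecMul v (selMatrix Q h)ᴴ k = v (Q.orderIsoOfFin h k) := by
    rw [Matrix.vecMul, dotProduct, Finset.sum_eq_single (Q.orderIsoOfFin h k : Fin n)]
    · simp [selMatrix]
    · intro a _ ha
      rw [Matrix.conjTranspose_apply, selMatrix, Matrix.of_apply, if_neg ha, star_zero, mul_zero]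
    · simp
  have hsum : Matrix.vecMul (Matrix.vecMul v (selMatrix Q h)ᴴ) (selMatrix Q h) j
      = ∑ k, if j = (Q.orderIsoOfFin h k : Fin n) then v (Q.orderIsoOfFin h k) else 0 := by
    rw [Matrix.vecMul, dotProduct]
    refine Finset.sum_congr rfl fun k _ => ?_
    rw [hrow, selMatrix, Matrix.of_apply, mul_ite, mul_one, mul_zero]
  rw [hsum]
  by_cases hj : j ∈ Q
  · obtain ⟨k, hk⟩ := (Q.orderIsoOfFin h).surjective ⟨j, hj⟩
    rw [Finset.sum_eq_single k]
    · simp only [hk, if_true]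
    · intro l _ hl
      refine if_neg fun hjl => hl ((Q.orderIsoOfFin h).injective ?_)
      rw [hk]
      exact Subtype.ext hjl.symm
    · simp
  · rw [hv j hj]
    refine Finset.sum_eq_zero fun k _ => if_neg fun hjk => hj ?_
    rw [hjk]
    exact (Q.orderIsoOfFin h k).2

/-- for arbitrary `A ∈ ℂ^{n×n}` and row vector `C_i ∈ ℂ^{1×n}`, with
`Ã_i := H_i A H_iᴴ` and `C̃_i := C_i H_iᴴ`, one has `C̃_i Ã_i^k = C_i A^k H_iᴴ` for every
`k ≥ 0`; consequently the `n`-row stacked matrix whose `k`-th row is `C̃_i Ã_i^{k-1}`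
(`k = 1,…,n`) equals `O_i H_iᴴ`. -/
theorem stmt6 {n m : ℕ} (A : Matrix (Fin n) (Fin n) ℂ)
    (C : Matrix (Fin m) (Fin n) ℂ) (i : Fin m)
    {d : ℕ} (hd : (colSupport (obsMat A (C i))).card = d)
    (Hi : Matrix (Fin d) (Fin n) ℂ) (hHi : Hi = selMatrix (colSupport (obsMat A (C i))) hd)
    (Atil : Matrix (Fin d) (Fin d) ℂ) (hAtil : Atil = Hi * A * Hiᴴ)
    (ctil : Fin d → ℂ) (hctil : ctil = Matrix.vecMul (C i) Hiᴴ) :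
    (∀ k : ℕ, Matrix.vecMul ctil (Atil ^ k) = Matrix.vecMul (Matrix.vecMul (C i) (A ^ k)) Hiᴴ) ∧
    Matrix.of (fun (k : Fin n) (l : Fin d) => Matrix.vecMul ctil (Atil ^ (k : ℕ)) l)
      = obsMat A (C i) * Hiᴴ := by
  subst hHi hAtil hctil
  have hsupp (k : ℕ) : ∀ j ∉ colSupport (obsMat A (C i)), Matrix.vecMul (C i) (A ^ k) j = 0 := by
    intro j hj
    refine vecMul_pow_apply_eq_zero A (C i) j (fun l => ?_) k
    by_contra hl
    exact hj (by simpa [colSupport] using ⟨l, hl⟩)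
  have hpow (k : ℕ) : Matrix.vecMul (Matrix.vecMul (C i) (selMatrix _ hd)ᴴ)
      ((selMatrix _ hd * A * (selMatrix _ hd)ᴴ) ^ k)
      = Matrix.vecMul (Matrix.vecMul (C i) (A ^ k)) (selMatrix _ hd)ᴴ := by
    induction k with
    | zero => simp
    | succ k ih =>
      rw [pow_succ, ← Matrix.vecMul_vecMul, ih, ← Matrix.vecMul_vecMul, ← Matrix.vecMul_vecMul,
        vecMul_selMatrix_conjTranspose_vecMul_selMatrix _ hd _ (hsupp k), Matrix.vecMul_vecMul _ _ A,
        ← pow_succ]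
  refine ⟨hpow, ?_⟩
  ext k l
  rw [Matrix.of_apply, hpow]
  rfl
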